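/- Let d ≥ 1, α > 0, and let μ be a probability measure on ℝᵈ with finite first moment. Then the infimum of F_μ(ρ) over all probability measures ρ on ℝᵈ with finite first moment equals the infimum of F_μ(ρ) over those ρ that additionally satisfy b(ρ) = −(1/α)·b(μ). Moreover, every minimizer ρ of F_μ satisfies b(ρ) = −(1/α)·b(μ). In particular, if b(μ) = 0 then every minimizer is centered: b(ρ) = 0. -/

import Mathlib

open MeasureTheory ENNReal
open scoped RealInnerProductSpace

noncomputable section

/-- Euclidean space `ℝᵈ`. -/
abbrev Ed (d : ℕ) := EuclideanSpace ℝ (Fin d)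

/-- The positive part of an extended real number, as an element of `ℝ≥0∞`. -/
noncomputable def EReal.posPart (a : EReal) : ℝ≥0∞ :=
  if a = ⊤ then ⊤ else ENNReal.ofReal a.toReal

/-- Signed integral (with values in `EReal`) of a real-valued function. -/
noncomputable def sInt {α : Type*} [MeasurableSpace α] (ν : Measure α) (g : α → ℝ) : EReal :=
  ((∫⁻ x, ENNReal.ofReal (g x) ∂ν : ℝ≥0∞) : EReal) -
    ((∫⁻ x, ENNReal.ofReal (-(g x)) ∂ν : ℝ≥0∞) : EReal)

/-- Signed integral (with values in `EReal`) of an `EReal`-valued function. -/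
noncomputable def eInt {α : Type*} [MeasurableSpace α] (ν : Measure α) (f : α → EReal) : EReal :=
  ((∫⁻ x, (f x).posPart ∂ν : ℝ≥0∞) : EReal) - ((∫⁻ x, (-(f x)).posPart ∂ν : ℝ≥0∞) : EReal)

/-- The set of couplings (transport plans) between two measures on `ℝᵈ`. -/
def couplings {d : ℕ} (ρ μ : Measure (Ed d)) : Set (Measure (Ed d × Ed d)) :=
  {γ | IsProbabilityMeasure γ ∧ γ.map Prod.fst = ρ ∧ γ.map Prod.snd = μ}

/-- The maximal correlation functional `T(ρ, μ)`. -/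
noncomputable def maxCorr {d : ℕ} (ρ μ : Measure (Ed d)) : EReal :=
  ⨆ γ ∈ couplings ρ μ, sInt γ (fun p => ⟪p.1, p.2⟫)

/-- The entropy `E(ρ)` of a measure with respect to Lebesgue measure. -/
noncomputable def Ent {d : ℕ} (ρ : Measure (Ed d)) : EReal := by
  classical
  exact if _h : ρ ≪ (volume : Measure (Ed d)) then
    sInt (volume : Measure (Ed d))
      (fun x => (ρ.rnDeriv volume x).toReal * Real.log (ρ.rnDeriv volume x).toReal)
  else ⊤

/-- The second moment of a measure, with values in `ℝ≥0∞`. -/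
noncomputable def M2e {d : ℕ} (ρ : Measure (Ed d)) : ℝ≥0∞ :=
  ∫⁻ x, ENNReal.ofReal (‖x‖ ^ 2) ∂ρ

/-- The regularized functional `F_μ(ρ) = E(ρ) + T(ρ, μ) + (α/2) M₂(ρ)`. -/
noncomputable def Ffun {d : ℕ} (α : ℝ) (μ ρ : Measure (Ed d)) : EReal :=
  Ent ρ + maxCorr ρ μ + ((α / 2 : ℝ) : EReal) * ((M2e ρ : ℝ≥0∞) : EReal)

/-- The `p`-th moment `M_p(ρ) = ∫ ‖x‖^p dρ`. -/
noncomputable def Mp {d : ℕ} (p : ℝ) (ρ : Measure (Ed d)) : ℝ :=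
  ∫ x, ‖x‖ ^ p ∂ρ

/-- The barycenter `b(ρ) = ∫ x dρ`. -/
noncomputable def bary {d : ℕ} (ρ : Measure (Ed d)) : Ed d :=
  ∫ x, x ∂ρ

/-- Probability measures on `ℝᵈ` with finite first moment. -/
def P1 (d : ℕ) : Set (Measure (Ed d)) :=
  {ρ | IsProbabilityMeasure ρ ∧ Integrable (fun x => ‖x‖) ρ}

/-- Probability measures on `ℝᵈ` with finite second moment. -/
def P2 (d : ℕ) : Set (Measure (Ed d)) :=
  {ρ | IsProbabilityMeasure ρ ∧ Integrable (fun x => ‖x‖ ^ 2) ρ}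

/-- `ρ` is a minimizer of `F_μ` over probability measures with finite first moment. -/
def IsMinOfF {d : ℕ} (α : ℝ) (μ ρ : Measure (Ed d)) : Prop :=
  ρ ∈ P1 d ∧ ∀ σ ∈ P1 d, Ffun α μ ρ ≤ Ffun α μ σ

/-- The 2-Wasserstein distance between two measures on `ℝᵈ`. -/
noncomputable def W2 {d : ℕ} (ρ μ : Measure (Ed d)) : ℝ :=
  Real.sqrt ((⨅ γ ∈ couplings ρ μ, ∫⁻ p, ENNReal.ofReal (‖p.1 - p.2‖ ^ 2) ∂γ).toReal)

/-- Convexity of an `EReal`-valued function on `ℝᵈ`. -/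
def EConvexOn {d : ℕ} (u : Ed d → EReal) : Prop :=
  ∀ x y : Ed d, ∀ s t : ℝ, 0 ≤ s → 0 ≤ t → s + t = 1 →
    u (s • x + t • y) ≤ (s : EReal) * u x + (t : EReal) * u y

/-- The Legendre transform `u*(y) = sup_x (⟨x, y⟩ - u(x))` of an `EReal`-valued function. -/
noncomputable def legendre {d : ℕ} (u : Ed d → EReal) : Ed d → EReal :=
  fun y => ⨆ x : Ed d, (((⟪x, y⟫ : ℝ) : EReal) - u x)

/-- The Gaussian-regularized density `exp(-u(x) - (α/2)‖x‖²)`, with value `0` where `u = ⊤`. -/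
noncomputable def gdens {d : ℕ} (α : ℝ) (u : Ed d → EReal) (x : Ed d) : ℝ≥0∞ :=
  if u x = ⊤ then 0 else ENNReal.ofReal (Real.exp (-(u x).toReal - (α / 2) * ‖x‖ ^ 2))

section SignedIntegral

variable {X Y : Type*} [MeasurableSpace X] [MeasurableSpace Y]

lemma sInt_map_equiv (e : X ≃ᵐ Y) (ν : Measure X) (g : Y → ℝ) :
    sInt (ν.map e) g = sInt ν (fun x => g (e x)) := by
  simp only [sInt, lintegral_map_equiv]

lemma sInt_congr_ae {ν : Measure X} {g h : X → ℝ} (hgh : g =ᵐ[ν] h) : sInt ν g = sInt ν h := by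
  unfold sInt
  congr 2
  · exact lintegral_congr_ae (hgh.mono fun x hx => by simp only [hx])
  · exact lintegral_congr_ae (hgh.mono fun x hx => by simp only [hx])

lemma sInt_ne_bot {ν : Measure X} {g : X → ℝ}
    (hg : ∫⁻ x, ENNReal.ofReal (-(g x)) ∂ν ≠ ⊤) : sInt ν g ≠ ⊥ := by
  unfold sInt
  rw [sub_eq_add_neg, EReal.add_ne_bot_iff]
  refine ⟨EReal.coe_ennreal_ne_bot _, ?_⟩
  simpa [EReal.neg_eq_bot_iff] using hg

lemma sInt_le_lintegral (ν : Measure X) (g : X → ℝ) :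
    sInt ν g ≤ ((∫⁻ x, ENNReal.ofReal (g x) ∂ν : ℝ≥0∞) : EReal) := by
  unfold sInt
  refine EReal.sub_le_of_le_add ?_
  exact le_add_of_nonneg_right (EReal.coe_ennreal_nonneg _)

lemma sInt_of_nonneg {ν : Measure X} {g : X → ℝ} (hg : ∀ x, 0 ≤ g x) :
    sInt ν g = ((∫⁻ x, ENNReal.ofReal (g x) ∂ν : ℝ≥0∞) : EReal) := by
  have h : ∀ x, ENNReal.ofReal (-(g x)) = 0 := fun x =>
    ENNReal.ofReal_of_nonpos (neg_nonpos.2 (hg x))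
  simp [sInt, h]

lemma ofReal_add_add_eq (a b : ℝ) :
    ENNReal.ofReal (a + b) + (ENNReal.ofReal (-a) + ENNReal.ofReal (-b)) =
      ENNReal.ofReal (-(a + b)) + (ENNReal.ofReal a + ENNReal.ofReal b) := by
  rw [← ENNReal.toReal_eq_toReal_iff' (by finiteness) (by finiteness)]
  simp only [ENNReal.toReal_add, ENNReal.ofReal_ne_top, ENNReal.add_ne_top, ne_eq,
    not_false_eq_true, and_self, ENNReal.toReal_ofReal']
  rcases max_cases (a + b) 0 with h | h <;> rcases max_cases (-(a + b)) 0 with h' | h' <;>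
    rcases max_cases a 0 with h1 | h1 <;> rcases max_cases (-a) 0 with h1' | h1' <;>
    rcases max_cases b 0 with h2 | h2 <;> rcases max_cases (-b) 0 with h2' | h2' <;> linarith

lemma coe_sub_coe_eq_of_add_eq {A B P N p n : ℝ≥0∞} (hp : p ≠ ⊤) (hn : n ≠ ⊤)
    (hA : A ≤ P + p) (hP : P ≤ A + n) (hB : B ≤ N + n) (hN : N ≤ B + p)
    (h : A + (N + n) = B + (P + p)) :
    (A : EReal) - B = (P : EReal) - N + ((p.toReal - n.toReal : ℝ) : EReal) := by
  by_cases hB' : B = ⊤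
  · have : N = ⊤ := by
      by_contra hN'
      exact (ENNReal.add_ne_top.2 ⟨hN', hn⟩) (top_le_iff.1 (hB' ▸ hB))
    simp [this, hB']
  have hN' : N ≠ ⊤ := ne_top_of_le_ne_top (ENNReal.add_ne_top.2 ⟨hB', hp⟩) hN
  by_cases hA' : A = ⊤
  · have : P = ⊤ := by
      by_contra hP'
      exact (ENNReal.add_ne_top.2 ⟨hP', hp⟩) (top_le_iff.1 (hA' ▸ hA))
    lift B to NNReal using hB'
    lift N to NNReal using hN'
    subst hA' this
    have e (z : NNReal) : (((z : ℝ≥0∞) : EReal)) = ((z : ℝ) : EReal) := rfl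
    rw [e, e, EReal.coe_ennreal_top, EReal.top_sub_coe, EReal.top_sub_coe, EReal.top_add_coe]
  have hP' : P ≠ ⊤ := ne_top_of_le_ne_top (ENNReal.add_ne_top.2 ⟨hA', hn⟩) hP
  lift A to NNReal using hA'
  lift B to NNReal using hB'
  lift N to NNReal using hN'
  lift P to NNReal using hP'
  lift p to NNReal using hp
  lift n to NNReal using hn
  have e (z : NNReal) : (((z : ℝ≥0∞) : EReal)) = ((z : ℝ) : EReal) := rfl
  simp only [e, ← EReal.coe_sub, ← EReal.coe_add, ENNReal.coe_toReal, EReal.coe_eq_coe_iff]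
  have h' : (A : ℝ) + (N + n) = B + (P + p) := by exact_mod_cast h
  linarith

lemma sInt_add_integrable {ν : Measure X} {g h : X → ℝ} (hg : Measurable g)
    (hh : Measurable h) (hi : Integrable h ν) :
    sInt ν (fun x => g x + h x) = sInt ν g + ((∫ x, h x ∂ν : ℝ) : EReal) := by
  rw [integral_eq_lintegral_pos_part_sub_lintegral_neg_part hi]
  have key (a b : ℝ) : ENNReal.ofReal a ≤ ENNReal.ofReal (a + b) + ENNReal.ofReal (-b) := by
    simpa using ENNReal.ofReal_add_le (p := a + b) (q := -b)
  refine coe_sub_coe_eq_of_add_eq hi.lintegral_lt_top.ne hi.neg.lintegral_lt_top.ne ?_ ?_ ?_ ?_ ?_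
  · rw [← lintegral_add_left (by fun_prop)]
    exact lintegral_mono fun x => ENNReal.ofReal_add_le
  · rw [← lintegral_add_left (by fun_prop)]
    exact lintegral_mono fun x => key _ _
  · rw [← lintegral_add_left (by fun_prop)]
    refine lintegral_mono fun x => ?_
    simp only [neg_add]
    exact ENNReal.ofReal_add_le
  · rw [← lintegral_add_left (by fun_prop)]
    refine lintegral_mono fun x => ?_
    simpa only [neg_add, neg_neg] using key (-(g x)) (-(h x))
  · rw [← lintegral_add_left (by fun_prop), ← lintegral_add_left (by fun_prop),
      ← lintegral_add_left (by fun_prop), ← lintegral_add_left (by fun_prop)]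
    exact lintegral_congr fun x => ofReal_add_add_eq _ _

end SignedIntegral

section Translation

variable {d : ℕ}

lemma P1.integrable_id {ρ : Measure (Ed d)} (hρ : ρ ∈ P1 d) : Integrable (fun x => x) ρ :=
  (integrable_norm_iff (by fun_prop)).1 hρ.2

/-- Translation of a measure by the vector `v`. -/
def translateBy (v : Ed d) (ρ : Measure (Ed d)) : Measure (Ed d) :=
  ρ.map (MeasurableEquiv.addRight v)

lemma translate_mem_P1 (v : Ed d) {ρ : Measure (Ed d)} (hρ : ρ ∈ P1 d) :
    translateBy v ρ ∈ P1 d := by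
  have := hρ.1
  refine ⟨Measure.isProbabilityMeasure_map (by fun_prop), ?_⟩
  rw [translateBy, integrable_map_equiv]
  exact ((P1.integrable_id hρ).add (integrable_const v)).norm

lemma bary_translate (v : Ed d) {ρ : Measure (Ed d)} (hρ : ρ ∈ P1 d) :
    bary (translateBy v ρ) = bary ρ + v := by
  have := hρ.1
  rw [bary, translateBy, integral_map_equiv]
  simp only [MeasurableEquiv.coe_addRight]
  rw [integral_add (P1.integrable_id hρ) (integrable_const v)]
  simp [bary]

lemma Ent_translate_le (v : Ed d) {ρ : Measure (Ed d)} (hρ : ρ ∈ P1 d) :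
    Ent (translateBy v ρ) ≤ Ent ρ := by
  have := hρ.1
  by_cases hac : ρ ≪ (volume : Measure (Ed d))
  swap
  · simp [Ent, hac]
  set e := MeasurableEquiv.addRight v
  have hvol : (volume : Measure (Ed d)).map e = volume := map_add_right_eq_self volume v
  have hac' : translateBy v ρ ≪ (volume : Measure (Ed d)) := by
    have := hac.map e.measurable
    rwa [hvol] at this
  have hrn := e.measurableEmbedding.rnDeriv_map ρ (volume : Measure (Ed d))
  rw [hvol] at hrn
  refine le_of_eq ?_
  simp only [Ent, hac, hac', dif_pos]
  nth_rewrite 1 [← hvol]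
  rw [sInt_map_equiv]
  refine sInt_congr_ae ?_
  filter_upwards [hrn] with x hx
  change (translateBy v ρ).rnDeriv volume (e x) = _ at hx
  rw [hx]

lemma measurable_inner_prod : Measurable (fun p : Ed d × Ed d => (⟪p.1, p.2⟫ : ℝ)) :=
  (continuous_fst.inner continuous_snd).measurable

lemma maxCorr_translate_le (v : Ed d) (ρ : Measure (Ed d)) {μ : Measure (Ed d)}
    (hμ : μ ∈ P1 d) :
    maxCorr (translateBy v ρ) μ ≤ maxCorr ρ μ + ((⟪v, bary μ⟫ : ℝ) : EReal) := by
  refine iSup₂_le fun γ hγ => ?_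
  obtain ⟨hγp, hγ1, hγ2⟩ := hγ
  set e : (Ed d × Ed d) ≃ᵐ (Ed d × Ed d) :=
    (MeasurableEquiv.addRight v).prodCongr (MeasurableEquiv.refl _)
  have hγe : γ = (γ.map e.symm).map e := by simp
  set γ' := γ.map e.symm with hγ'
  have h1 : γ'.map Prod.fst = ρ := by
    have : γ'.map Prod.fst = (γ.map Prod.fst).map (MeasurableEquiv.addRight v).symm := by
      rw [hγ', Measure.map_map (by fun_prop) (by fun_prop),
        Measure.map_map (by fun_prop) (by fun_prop)]
      rfl
    rw [this, hγ1, translateBy, MeasurableEquiv.map_symm_map]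
  have h2 : γ'.map Prod.snd = μ := by
    rw [← hγ2, hγ', Measure.map_map (by fun_prop) (by fun_prop)]
    rfl
  have hprob : IsProbabilityMeasure γ' := Measure.isProbabilityMeasure_map (by fun_prop)
  have hint : Integrable (fun p : Ed d × Ed d => (⟪v, p.2⟫ : ℝ)) γ' := by
    have : Integrable (fun y : Ed d => (⟪v, y⟫ : ℝ)) (γ'.map Prod.snd) := by
      rw [h2]; exact (P1.integrable_id hμ).const_inner v
    exact this.comp_measurable measurable_snd
  have hval : ∫ p : Ed d × Ed d, (⟪v, p.2⟫ : ℝ) ∂γ' = ⟪v, bary μ⟫ := by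
    rw [bary, ← integral_inner (P1.integrable_id hμ)]
    nth_rewrite 1 [← h2]
    exact (integral_map (φ := Prod.snd) (by fun_prop) (by fun_prop)).symm
  have hsplit : sInt γ (fun p => ⟪p.1, p.2⟫) =
      sInt γ' (fun p => ⟪p.1, p.2⟫) + ((⟪v, bary μ⟫ : ℝ) : EReal) := by
    rw [hγe, sInt_map_equiv, ← hval,
      ← sInt_add_integrable measurable_inner_prod (by fun_prop) hint]
    congr 1
    funext p
    exact inner_add_left p.1 v p.2
  rw [hsplit]
  gcongr
  exact le_iSup₂ (f := fun (γ : Measure (Ed d × Ed d)) (_ : γ ∈ couplings ρ μ) =>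
    sInt γ (fun p => ⟪p.1, p.2⟫)) γ' ⟨hprob, h1, h2⟩

lemma M2e_translate (v : Ed d) {ρ : Measure (Ed d)} (hρ : ρ ∈ P1 d) :
    (M2e (translateBy v ρ) : EReal) =
      (M2e ρ : EReal) + ((2 * ⟪v, bary ρ⟫ + ‖v‖ ^ 2 : ℝ) : EReal) := by
  have := hρ.1
  have hi : Integrable (fun x : Ed d => 2 * (⟪v, x⟫ : ℝ)) ρ :=
    ((P1.integrable_id hρ).const_inner v).const_mul 2
  have hval : ∫ x, (2 * ⟪v, x⟫ + ‖v‖ ^ 2 : ℝ) ∂ρ = 2 * ⟪v, bary ρ⟫ + ‖v‖ ^ 2 := by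
    rw [integral_add hi (integrable_const _), integral_const_mul,
      integral_inner (P1.integrable_id hρ)]
    simp [bary]
  rw [M2e, M2e, ← sInt_of_nonneg (fun x => by positivity), ← sInt_of_nonneg (fun x => by positivity),
    translateBy, sInt_map_equiv, ← hval,
    ← sInt_add_integrable (h := fun x => (2 * ⟪v, x⟫ + ‖v‖ ^ 2 : ℝ)) (by fun_prop)
      (by fun_prop) (hi.add (integrable_const _))]
  congr 1
  funext x
  change ‖x + v‖ ^ 2 = _
  rw [norm_add_sq_real, real_inner_comm]
  ring

lemma Ffun_translate_le {α : ℝ} (hα : 0 < α) (v : Ed d) {ρ μ : Measure (Ed d)}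
    (hρ : ρ ∈ P1 d) (hμ : μ ∈ P1 d) :
    Ffun α μ (translateBy v ρ) ≤
      Ffun α μ ρ + ((⟪v, bary μ + α • bary ρ⟫ + α / 2 * ‖v‖ ^ 2 : ℝ) : EReal) := by
  have hnn : (0 : EReal) ≤ ((α / 2 : ℝ) : EReal) := by exact_mod_cast (by positivity)
  have hsum : (⟪v, bary μ + α • bary ρ⟫ + α / 2 * ‖v‖ ^ 2 : ℝ) =
      ⟪v, bary μ⟫ + α / 2 * (2 * ⟪v, bary ρ⟫ + ‖v‖ ^ 2) := by
    rw [inner_add_right, real_inner_smul_right]; ring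
  rw [Ffun, Ffun, M2e_translate v hρ,
    EReal.left_distrib_of_nonneg_of_ne_top hnn (EReal.coe_ne_top _), ← EReal.coe_mul, hsum,
    EReal.coe_add]
  refine (add_le_add_left (add_le_add (Ent_translate_le v hρ) (maxCorr_translate_le v ρ hμ))
    _).trans (le_of_eq ?_)
  abel

/-- Translating `ρ` to the barycenter `-(1/α) b(μ)` lowers `F_μ` by at least
`(α/2)‖b(ρ) + (1/α) b(μ)‖²`. -/
lemma Ffun_recenter_le {α : ℝ} (hα : 0 < α) {ρ μ : Measure (Ed d)}
    (hρ : ρ ∈ P1 d) (hμ : μ ∈ P1 d) {v : Ed d} (hv : v = (-(1 / α)) • bary μ - bary ρ) :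
    Ffun α μ (translateBy v ρ) ≤ Ffun α μ ρ + ((-(α / 2 * ‖v‖ ^ 2) : ℝ) : EReal) := by
  have h : bary μ + α • bary ρ = (-α) • v := by
    rw [hv, smul_sub, smul_smul]
    have : -α * -(1 / α) = 1 := by field_simp
    rw [this, one_smul, neg_smul, sub_neg_eq_add]
  have := Ffun_translate_le hα v hρ hμ
  rw [h, real_inner_smul_right, real_inner_self_eq_norm_sq] at this
  convert this using 3
  ring

end Translation

section Finiteness

variable {d : ℕ}

lemma neg_mul_log_le {t : ℝ} (ht : 0 ≤ t) (s : ℝ) :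
    -(t * Real.log t) ≤ t * s + Real.exp (-s) := by
  rcases ht.eq_or_lt with rfl | ht
  · simpa using (Real.exp_pos _).le
  have h := Real.add_one_le_exp (-s - Real.log t)
  rw [Real.exp_sub, Real.exp_log ht, le_div_iff₀ ht] at h
  nlinarith

lemma Ent_ne_bot {ρ : Measure (Ed d)} (hρ : ρ ∈ P1 d) : Ent ρ ≠ ⊥ := by
  have := hρ.1
  by_cases hac : ρ ≪ (volume : Measure (Ed d))
  swap
  · simp [Ent, hac]
  simp only [Ent, hac, dif_pos]
  refine sInt_ne_bot ?_
  set r : ℝ := d + 1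
  have hr : 0 ≤ r := by positivity
  have hjap : Integrable (fun x : Ed d => (1 + ‖x‖) ^ (-r)) volume :=
    integrable_one_add_norm (by simp [r])
  have hbound : ∀ x : Ed d, ENNReal.ofReal
      (-((ρ.rnDeriv volume x).toReal * Real.log (ρ.rnDeriv volume x).toReal)) ≤
      ρ.rnDeriv volume x * ENNReal.ofReal (r * ‖x‖) + ENNReal.ofReal ((1 + ‖x‖) ^ (-r)) := by
    intro x
    set t := (ρ.rnDeriv volume x).toReal
    have h1 : 0 < 1 + ‖x‖ := by positivity
    have h2 := neg_mul_log_le (t := t) ENNReal.toReal_nonneg (r * Real.log (1 + ‖x‖))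
    have h3 : Real.exp (-(r * Real.log (1 + ‖x‖))) = (1 + ‖x‖) ^ (-r) := by
      rw [Real.rpow_def_of_pos h1]; congr 1; ring
    have h4 : Real.log (1 + ‖x‖) ≤ ‖x‖ := by linarith [Real.log_le_sub_one_of_pos h1]
    have h5 : -(t * Real.log t) ≤ t * (r * ‖x‖) + (1 + ‖x‖) ^ (-r) := by
      rw [h3] at h2
      have : t * (r * Real.log (1 + ‖x‖)) ≤ t * (r * ‖x‖) := by gcongr
      linarith
    refine (ENNReal.ofReal_le_ofReal h5).trans (ENNReal.ofReal_add_le.trans ?_)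
    rw [ENNReal.ofReal_mul ENNReal.toReal_nonneg]
    gcongr
    exact ENNReal.ofReal_toReal_le
  refine ne_top_of_le_ne_top ?_ (lintegral_mono hbound)
  rw [lintegral_add_left (by fun_prop), lintegral_rnDeriv_mul hac (by fun_prop)]
  exact ENNReal.add_ne_top.2 ⟨(hρ.2.const_mul r).lintegral_lt_top.ne, hjap.lintegral_lt_top.ne⟩

lemma maxCorr_ne_bot {ρ μ : Measure (Ed d)} (hρ : ρ ∈ P1 d) (hμ : μ ∈ P1 d) :
    maxCorr ρ μ ≠ ⊥ := by
  have := hρ.1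
  have := hμ.1
  have hmem : ρ.prod μ ∈ couplings ρ μ := ⟨inferInstance, by simp, by simp⟩
  have hi : Integrable (fun p : Ed d × Ed d => (⟪p.1, p.2⟫ : ℝ)) (ρ.prod μ) :=
    (hρ.2.mul_prod hμ.2).mono' measurable_inner_prod.aestronglyMeasurable
      (Filter.Eventually.of_forall fun p => norm_inner_le_norm p.1 p.2)
  have hne : sInt (ρ.prod μ) (fun p => ⟪p.1, p.2⟫) ≠ ⊥ :=
    sInt_ne_bot hi.neg.lintegral_lt_top.ne
  exact ne_bot_of_le_ne_bot hne (le_iSup₂ (f := fun (γ : Measure (Ed d × Ed d))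
    (_ : γ ∈ couplings ρ μ) => sInt γ (fun p => ⟪p.1, p.2⟫)) _ hmem)

lemma Ffun_ne_bot {α : ℝ} (hα : 0 < α) {ρ μ : Measure (Ed d)} (hρ : ρ ∈ P1 d)
    (hμ : μ ∈ P1 d) : Ffun α μ ρ ≠ ⊥ := by
  have hnn : (0 : EReal) ≤ ((α / 2 : ℝ) : EReal) := by exact_mod_cast (by positivity)
  rw [Ffun, EReal.add_ne_bot_iff, EReal.add_ne_bot_iff]
  exact ⟨⟨Ent_ne_bot hρ, maxCorr_ne_bot hρ hμ⟩,
    ne_bot_of_le_ne_bot EReal.zero_ne_bot (mul_nonneg hnn (EReal.coe_ennreal_nonneg _))⟩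

lemma maxCorr_ne_top_of_ae_norm_le {ρ μ : Measure (Ed d)} (hμ : μ ∈ P1 d)
    (hρ : ∀ᵐ x ∂ρ, ‖x‖ ≤ 1) : maxCorr ρ μ ≠ ⊤ := by
  have hfin : ∫⁻ y, ENNReal.ofReal ‖y‖ ∂μ ≠ ⊤ := hμ.2.lintegral_lt_top.ne
  refine ne_top_of_le_ne_top (mt EReal.coe_ennreal_eq_top_iff.1 hfin) ?_
  refine iSup₂_le fun γ ⟨_, hγ1, hγ2⟩ => (sInt_le_lintegral _ _).trans ?_
  rw [EReal.coe_ennreal_le_coe_ennreal_iff, ← hγ2, lintegral_map (by fun_prop) measurable_snd]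
  rw [← hγ1] at hρ
  refine lintegral_mono_ae ?_
  filter_upwards [ae_of_ae_map (by fun_prop) hρ] with p hp
  refine ENNReal.ofReal_le_ofReal ((real_inner_le_norm _ _).trans ?_)
  exact mul_le_of_le_one_left (norm_nonneg _) hp

/-- The uniform probability measure on the unit ball. -/
def unifBall (d : ℕ) : Measure (Ed d) :=
  volume.withDensity ((Metric.ball (0 : Ed d) 1).indicator
    fun _ => (volume (Metric.ball (0 : Ed d) 1))⁻¹)

lemma unifBall_eq_smul_restrict (d : ℕ) : unifBall d =
    (volume (Metric.ball (0 : Ed d) 1))⁻¹ • volume.restrict (Metric.ball (0 : Ed d) 1) := by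
  rw [unifBall, withDensity_indicator measurableSet_ball, withDensity_const]

lemma ae_norm_le_one_unifBall (d : ℕ) : ∀ᵐ x ∂unifBall d, ‖x‖ ≤ 1 := by
  rw [unifBall_eq_smul_restrict]
  refine Measure.ae_smul_measure ?_ _
  filter_upwards [ae_restrict_mem measurableSet_ball] with x hx
  exact (mem_ball_zero_iff.1 hx).le

lemma unifBall_mem_P1 (d : ℕ) : unifBall d ∈ P1 d := by
  have hp : IsProbabilityMeasure (unifBall d) := by
    rw [unifBall_eq_smul_restrict]
    exact ProbabilityTheory.cond_isProbabilityMeasure_of_finite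
      (Metric.measure_ball_pos volume _ one_pos).ne' measure_ball_lt_top.ne
  refine ⟨hp, (integrable_const (1 : ℝ)).mono' (by fun_prop) ?_⟩
  filter_upwards [ae_norm_le_one_unifBall d] with x hx
  simpa using hx

lemma Ent_unifBall_ne_top (d : ℕ) : Ent (unifBall d) ≠ ⊤ := by
  have hac : unifBall d ≪ volume := withDensity_absolutelyContinuous _ _
  simp only [Ent, hac, dif_pos]
  set c : ℝ := ((volume (Metric.ball (0 : Ed d) 1))⁻¹).toReal
  have hrn : (unifBall d).rnDeriv volume =ᵐ[volume] _ :=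
    Measure.rnDeriv_withDensity _ (measurable_const.indicator measurableSet_ball)
  refine ne_top_of_le_ne_top ?_ (sInt_le_lintegral _ _)
  rw [ne_eq, EReal.coe_ennreal_eq_top_iff]
  have hle : ∫⁻ x, ENNReal.ofReal (((unifBall d).rnDeriv volume x).toReal *
      Real.log ((unifBall d).rnDeriv volume x).toReal) ≤
      ∫⁻ x, (Metric.ball (0 : Ed d) 1).indicator
        (fun _ => ENNReal.ofReal (c * Real.log c)) x := by
    refine lintegral_mono_ae ?_
    filter_upwards [hrn] with x hx
    rw [hx]
    by_cases hxB : x ∈ Metric.ball (0 : Ed d) 1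
    · simp only [Set.indicator_of_mem hxB]; rfl
    · simp [Set.indicator_of_notMem hxB]
  refine ne_top_of_le_ne_top ?_ hle
  rw [lintegral_indicator_const measurableSet_ball]
  exact ENNReal.mul_ne_top ENNReal.ofReal_ne_top measure_ball_lt_top.ne

lemma M2e_unifBall_ne_top (d : ℕ) : M2e (unifBall d) ≠ ⊤ := by
  have := (unifBall_mem_P1 d).1
  have hle : M2e (unifBall d) ≤ ∫⁻ _, 1 ∂unifBall d := by
    refine lintegral_mono_ae ?_
    filter_upwards [ae_norm_le_one_unifBall d] with x hx
    exact ENNReal.ofReal_le_one.2 (pow_le_one₀ (norm_nonneg _) hx)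
  exact ne_top_of_le_ne_top (by simp) hle

lemma Ffun_unifBall_ne_top (α : ℝ) {μ : Measure (Ed d)} (hμ : μ ∈ P1 d) :
    Ffun α μ (unifBall d) ≠ ⊤ := by
  refine EReal.add_ne_top (EReal.add_ne_top (Ent_unifBall_ne_top d)
    (maxCorr_ne_top_of_ae_norm_le hμ (ae_norm_le_one_unifBall d))) ?_
  rw [← EReal.coe_ennreal_toReal (M2e_unifBall_ne_top d), ← EReal.coe_mul]
  exact EReal.coe_ne_top _

end Finiteness

lemma IsMinOfF.bary_eq {d : ℕ} {α : ℝ} (hα : 0 < α) {μ ρ : Measure (Ed d)} (hμ : μ ∈ P1 d)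
    (hmin : IsMinOfF α μ ρ) : bary ρ = (-(1 / α)) • bary μ := by
  obtain ⟨hρ, hle⟩ := hmin
  set v := (-(1 / α)) • bary μ - bary ρ with hv
  have h := (hle _ (translate_mem_P1 v hρ)).trans (Ffun_recenter_le hα hρ hμ hv)
  have htop : Ffun α μ ρ ≠ ⊤ :=
    ne_top_of_le_ne_top (Ffun_unifBall_ne_top α hμ) (hle _ (unifBall_mem_P1 d))
  rw [← EReal.coe_toReal htop (Ffun_ne_bot hα hρ hμ), ← EReal.coe_add,
    EReal.coe_le_coe_iff] at h
  have hv0 : ‖v‖ ^ 2 ≤ 0 := by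
    have : α / 2 * ‖v‖ ^ 2 ≤ 0 := by linarith
    exact nonpos_of_mul_nonpos_right this (by positivity)
  have : v = 0 := by simpa using le_antisymm hv0 (by positivity)
  exact (sub_eq_zero.1 (hv ▸ this)).symm

/-- the infimum of `F_μ` is attained with barycenter `-(1/α) b(μ)`,
and every minimizer has this barycenter; in particular if `b(μ) = 0` every minimizer
is centered. -/
theorem stmt3 (d : ℕ) (hd : 1 ≤ d) (α : ℝ) (hα : 0 < α)
    (μ : Measure (Ed d)) (hμ : μ ∈ P1 d) :
    (⨅ ρ ∈ P1 d, Ffun α μ ρ) =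
        (⨅ ρ ∈ {ρ ∈ P1 d | bary ρ = (-(1 / α)) • bary μ}, Ffun α μ ρ) ∧
      (∀ ρ : Measure (Ed d), IsMinOfF α μ ρ → bary ρ = (-(1 / α)) • bary μ) ∧
      (bary μ = 0 → ∀ ρ : Measure (Ed d), IsMinOfF α μ ρ → bary ρ = 0) := by
  refine ⟨le_antisymm ?_ ?_, fun ρ h => h.bary_eq hα hμ,
    fun h0 ρ h => by rw [h.bary_eq hα hμ, h0, smul_zero]⟩
  · exact le_iInf₂ fun ρ hρ => iInf₂_le ρ hρ.1
  · refine le_iInf₂ fun ρ hρ => ?_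
    set v := (-(1 / α)) • bary μ - bary ρ with hv
    refine (iInf₂_le (translateBy v ρ) ⟨translate_mem_P1 v hρ, ?_⟩).trans
      ((Ffun_recenter_le hα hρ hμ hv).trans ?_)
    · have hneg : ((-(α / 2 * ‖v‖ ^ 2) : ℝ) : EReal) ≤ 0 := by
        exact_mod_cast neg_nonpos.2 (by positivity)
      simpa using add_le_add_right hneg (Ffun α μ ρ)
    · rw [bary_translate v hρ, hv, add_sub_cancel]
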